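/- Suppose CG < Cp. For every (i,j,k,l) ∈ ℕ⁴ with i ≥ 0 and j+k+l = Cp (so that (i,j,k,l), (i+1,j,k,l) ∈ X), one has v(i+1,j,k,l) − v(i,j,k,l) ≥ min(h1/μ1, h2/μ2) + ((i+j+1)·h0/Cp)·(1/μ0) + ((i+1)·h0/Cp)·min(1/μ1, 1/μ2); in particular v(i+1,j,k,l) − v(i,j,k,l) ≥ min(h1/μ1, h2/μ2). -/

import Mathlib

/-- Total service rate `d(j,k,l) = j·μ0 + k·μ1 + min(l,CG)·μ2`. -/
noncomputable def dRate (μ0 μ1 μ2 : ℝ) (CG j k l : ℕ) : ℝ :=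
  (j : ℝ) * μ0 + (k : ℝ) * μ1 + ((min l CG : ℕ) : ℝ) * μ2

/-- The value function `v`, defined by well-founded recursion on `2(i+j)+k+l`.
For nonzero states of the state space it satisfies
`d(j,k,l) · v i j k l = holding costs + transition terms`
(terms with zero coefficient are guarded by `if` and contribute `0`). -/
noncomputable def v (μ0 μ1 μ2 h0 h1 h2 : ℝ) (CG : ℕ) : ℕ → ℕ → ℕ → ℕ → ℝ
  | 0, 0, 0, 0 => 0
  | 0, j, k, l =>
    ((j : ℝ) * h0 + (k : ℝ) * h1 + (l : ℝ) * h2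
      + (if _ : 1 ≤ j then
          (j : ℝ) * μ0 *
            min (v μ0 μ1 μ2 h0 h1 h2 CG 0 (j - 1) (k + 1) l)
                (v μ0 μ1 μ2 h0 h1 h2 CG 0 (j - 1) k (l + 1))
        else 0)
      + (if _ : 1 ≤ k then (k : ℝ) * μ1 * v μ0 μ1 μ2 h0 h1 h2 CG 0 j (k - 1) l else 0)
      + (if _ : 1 ≤ l then
          ((min l CG : ℕ) : ℝ) * μ2 * v μ0 μ1 μ2 h0 h1 h2 CG 0 j k (l - 1)
        else 0))
    / dRate μ0 μ1 μ2 CG j k l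
  | i + 1, j, k, l =>
    (((i : ℝ) + 1 + (j : ℝ)) * h0 + (k : ℝ) * h1 + (l : ℝ) * h2
      + (if _ : 1 ≤ j then
          (j : ℝ) * μ0 *
            min (v μ0 μ1 μ2 h0 h1 h2 CG (i + 1) (j - 1) (k + 1) l)
                (v μ0 μ1 μ2 h0 h1 h2 CG (i + 1) (j - 1) k (l + 1))
        else 0)
      + (if _ : 1 ≤ k then (k : ℝ) * μ1 * v μ0 μ1 μ2 h0 h1 h2 CG i (j + 1) (k - 1) l else 0)
      + (if _ : 1 ≤ l then
          ((min l CG : ℕ) : ℝ) * μ2 * v μ0 μ1 μ2 h0 h1 h2 CG i (j + 1) k (l - 1)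
        else 0))
    / dRate μ0 μ1 μ2 CG j k l
termination_by i j k l => 2 * (i + j) + k + l
decreasing_by all_goals omega

/-- Membership in the state space `X`. -/
def memX (Cp : ℕ) (i j k l : ℕ) : Prop :=
  (i = 0 ∧ j + k + l < Cp) ∨ j + k + l = Cp

theorem dRate_pos {μ0 μ1 μ2 : ℝ} {CG : ℕ} (hCG : 0 < CG)
    (hμ0 : 0 < μ0) (hμ1 : 0 < μ1) (hμ2 : 0 < μ2) (j k l : ℕ) (h : 0 < j + k + l) :
    0 < dRate μ0 μ1 μ2 CG j k l := by
  unfold dRate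
  rcases Nat.eq_zero_or_pos j with hj | hj
  · rcases Nat.eq_zero_or_pos k with hk | hk
    · have hl : 0 < min l CG := by omega
      have : (0 : ℝ) < ((min l CG : ℕ) : ℝ) := by exact_mod_cast hl
      positivity
    · have : (0 : ℝ) < k := by exact_mod_cast hk
      positivity
  · have : (0 : ℝ) < j := by exact_mod_cast hj
    positivity

theorem v_zero_eq {μ0 μ1 μ2 : ℝ} (h0 h1 h2 : ℝ) {CG : ℕ} (hCG : 0 < CG)
    (hμ0 : 0 < μ0) (hμ1 : 0 < μ1) (hμ2 : 0 < μ2) (j k l : ℕ) :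
    dRate μ0 μ1 μ2 CG j k l * v μ0 μ1 μ2 h0 h1 h2 CG 0 j k l
      = (j : ℝ) * h0 + (k : ℝ) * h1 + (l : ℝ) * h2
      + (j : ℝ) * μ0 * min (v μ0 μ1 μ2 h0 h1 h2 CG 0 (j - 1) (k + 1) l)
                (v μ0 μ1 μ2 h0 h1 h2 CG 0 (j - 1) k (l + 1))
      + (k : ℝ) * μ1 * v μ0 μ1 μ2 h0 h1 h2 CG 0 j (k - 1) l
      + ((min l CG : ℕ) : ℝ) * μ2 * v μ0 μ1 μ2 h0 h1 h2 CG 0 j k (l - 1) := by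
  by_cases hz : j = 0 ∧ k = 0 ∧ l = 0
  · obtain ⟨rfl, rfl, rfl⟩ := hz
    simp [dRate]
  · have hd := dRate_pos hCG hμ0 hμ1 hμ2 j k l (by omega)
    conv_lhs => rw [v.eq_2 _ _ _ _ _ _ _ _ _ _ (by tauto)]
    rw [mul_div_cancel₀ _ hd.ne']
    congr 1
    · congr 1
      · congr 1
        rcases Nat.eq_zero_or_pos j with h | h
        · simp [h]
        · exact dif_pos h
      · rcases Nat.eq_zero_or_pos k with h | h
        · simp [h]
        · exact dif_pos h
    · rcases Nat.eq_zero_or_pos l with h | h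
      · simp [h]
      · exact dif_pos h

theorem v_succ_eq {μ0 μ1 μ2 : ℝ} (h0 h1 h2 : ℝ) {CG : ℕ} (hCG : 0 < CG)
    (hμ0 : 0 < μ0) (hμ1 : 0 < μ1) (hμ2 : 0 < μ2) (i j k l : ℕ) (hp : 0 < j + k + l) :
    dRate μ0 μ1 μ2 CG j k l * v μ0 μ1 μ2 h0 h1 h2 CG (i + 1) j k l
      = ((i : ℝ) + 1 + (j : ℝ)) * h0 + (k : ℝ) * h1 + (l : ℝ) * h2
      + (j : ℝ) * μ0 * min (v μ0 μ1 μ2 h0 h1 h2 CG (i + 1) (j - 1) (k + 1) l)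
                (v μ0 μ1 μ2 h0 h1 h2 CG (i + 1) (j - 1) k (l + 1))
      + (k : ℝ) * μ1 * v μ0 μ1 μ2 h0 h1 h2 CG i (j + 1) (k - 1) l
      + ((min l CG : ℕ) : ℝ) * μ2 * v μ0 μ1 μ2 h0 h1 h2 CG i (j + 1) k (l - 1) := by
  have hd := dRate_pos hCG hμ0 hμ1 hμ2 j k l hp
  conv_lhs => rw [v.eq_3]
  rw [mul_div_cancel₀ _ hd.ne']
  congr 1
  · congr 1
    · congr 1
      rcases Nat.eq_zero_or_pos j with h | h
      · simp [h]
      · exact dif_pos h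
    · rcases Nat.eq_zero_or_pos k with h | h
      · simp [h]
      · exact dif_pos h
  · rcases Nat.eq_zero_or_pos l with h | h
    · simp [h]
    · exact dif_pos h

/-- Compare guarded terms: only the case of a positive counter matters. -/
theorem guarded_le (n m : ℕ) (hmn : m ≤ n) {μ x y c : ℝ} (hμ : 0 < μ)
    (h : 1 ≤ n → y + c ≤ x) : (m : ℝ) * μ * y + (m : ℝ) * μ * c ≤ (m : ℝ) * μ * x := by
  rcases Nat.eq_zero_or_pos n with hn | hn
  · have : m = 0 := by omega
    simp [this]
  · rw [← mul_add]
    exact mul_le_mul_of_nonneg_left (h hn) (by positivity)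

theorem min_add_le {a b a' b' c : ℝ} (ha : a + c ≤ a') (hb : b + c ≤ b') :
    min a b + c ≤ min a' b' :=
  le_min ((add_le_add_left (min_le_left a b) c).trans ha)
    ((add_le_add_left (min_le_right a b) c).trans hb)

theorem extra_one {μ0 μ1 μ2 : ℝ} (h0 h1 h2 : ℝ) {CG : ℕ} (hCG : 0 < CG)
    (hμ0 : 0 < μ0) (hμ1 : 0 < μ1) (hμ2 : 0 < μ2) (n : ℕ) : ∀ j k l : ℕ, 2 * j + k + l = n →
    v μ0 μ1 μ2 h0 h1 h2 CG 0 j k l + h1 / μ1 ≤ v μ0 μ1 μ2 h0 h1 h2 CG 0 j (k + 1) l := by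
  induction n using Nat.strong_induction_on with
  | _ n ih =>
  intro j k l hn
  have e := v_zero_eq h0 h1 h2 hCG hμ0 hμ1 hμ2 j k l
  have e' := v_zero_eq h0 h1 h2 hCG hμ0 hμ1 hμ2 j (k + 1) l
  have hd := dRate_pos hCG hμ0 hμ1 hμ2 j (k + 1) l (by omega)
  have t0 := guarded_le j j le_rfl hμ0
    (x := min (v μ0 μ1 μ2 h0 h1 h2 CG 0 (j - 1) (k + 1 + 1) l)
      (v μ0 μ1 μ2 h0 h1 h2 CG 0 (j - 1) (k + 1) (l + 1)))
    (y := min (v μ0 μ1 μ2 h0 h1 h2 CG 0 (j - 1) (k + 1) l)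
      (v μ0 μ1 μ2 h0 h1 h2 CG 0 (j - 1) k (l + 1))) (c := h1 / μ1)
    (fun hj => min_add_le (ih _ (by omega) (j - 1) (k + 1) l rfl)
      (ih _ (by omega) (j - 1) k (l + 1) rfl))
  have t1 := guarded_le k k le_rfl hμ1
    (x := v μ0 μ1 μ2 h0 h1 h2 CG 0 j k l)
    (y := v μ0 μ1 μ2 h0 h1 h2 CG 0 j (k - 1) l) (c := h1 / μ1)
    (fun hk => by
      have := ih _ (by omega) j (k - 1) l rfl
      rwa [Nat.sub_add_cancel hk] at this)
  have t2 := guarded_le l (min l CG) (min_le_left _ _) hμ2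
    (x := v μ0 μ1 μ2 h0 h1 h2 CG 0 j (k + 1) (l - 1))
    (y := v μ0 μ1 μ2 h0 h1 h2 CG 0 j k (l - 1)) (c := h1 / μ1)
    (fun hl => ih _ (by omega) j k (l - 1) rfl)
  have hh : h1 = μ1 * (h1 / μ1) := by field_simp
  refine le_of_mul_le_mul_left ?_ hd
  simp only [Nat.add_sub_cancel] at e'
  unfold dRate at *
  generalize h1 / μ1 = a at *
  push_cast at *
  linarith

theorem extra_two {μ0 μ1 μ2 : ℝ} (h0 h1 h2 : ℝ) {CG : ℕ} (hCG : 0 < CG)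
    (hμ0 : 0 < μ0) (hμ1 : 0 < μ1) (hμ2 : 0 < μ2) (hh2 : 0 < h2)
    (n : ℕ) : ∀ j k l : ℕ, 2 * j + k + l = n →
    v μ0 μ1 μ2 h0 h1 h2 CG 0 j k l + h2 / μ2 ≤ v μ0 μ1 μ2 h0 h1 h2 CG 0 j k (l + 1) := by
  induction n using Nat.strong_induction_on with
  | _ n ih =>
  intro j k l hn
  have e := v_zero_eq h0 h1 h2 hCG hμ0 hμ1 hμ2 j k l
  have e' := v_zero_eq h0 h1 h2 hCG hμ0 hμ1 hμ2 j k (l + 1)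
  have hd := dRate_pos hCG hμ0 hμ1 hμ2 j k (l + 1) (by omega)
  have t0 := guarded_le j j le_rfl hμ0
    (x := min (v μ0 μ1 μ2 h0 h1 h2 CG 0 (j - 1) (k + 1) (l + 1))
      (v μ0 μ1 μ2 h0 h1 h2 CG 0 (j - 1) k (l + 1 + 1)))
    (y := min (v μ0 μ1 μ2 h0 h1 h2 CG 0 (j - 1) (k + 1) l)
      (v μ0 μ1 μ2 h0 h1 h2 CG 0 (j - 1) k (l + 1))) (c := h2 / μ2)
    (fun hj => min_add_le (ih _ (by omega) (j - 1) (k + 1) l rfl)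
      (ih _ (by omega) (j - 1) k (l + 1) rfl))
  have t1 := guarded_le k k le_rfl hμ1
    (x := v μ0 μ1 μ2 h0 h1 h2 CG 0 j (k - 1) (l + 1))
    (y := v μ0 μ1 μ2 h0 h1 h2 CG 0 j (k - 1) l) (c := h2 / μ2)
    (fun hk => ih _ (by omega) j (k - 1) l rfl)
  have t2 := guarded_le l (min l CG) (min_le_left _ _) hμ2
    (x := v μ0 μ1 μ2 h0 h1 h2 CG 0 j k l)
    (y := v μ0 μ1 μ2 h0 h1 h2 CG 0 j k (l - 1)) (c := h2 / μ2)
    (fun hl => by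
      have := ih _ (by omega) j k (l - 1) rfl
      rwa [Nat.sub_add_cancel hl] at this)
  have hh : h2 = μ2 * (h2 / μ2) := by field_simp
  refine le_of_mul_le_mul_left ?_ hd
  simp only [Nat.add_sub_cancel] at e'
  unfold dRate at *
  generalize h2 / μ2 = a at *
  rcases Nat.lt_or_ge l CG with hl | hl
  · rw [min_eq_left (show l ≤ CG by omega)] at *
    rw [min_eq_left (show l + 1 ≤ CG by omega)] at *
    push_cast at *
    linarith
  · rw [min_eq_right hl] at *
    rw [min_eq_right (show CG ≤ l + 1 by omega)] at *
    push_cast at *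
    linarith

theorem extra_zero {μ0 μ1 μ2 : ℝ} (h0 h1 h2 : ℝ) {CG : ℕ} (hCG : 0 < CG)
    (hμ0 : 0 < μ0) (hμ1 : 0 < μ1) (hμ2 : 0 < μ2) (hh2 : 0 < h2)
    (n : ℕ) : ∀ j k l : ℕ, 2 * j + k + l = n →
    v μ0 μ1 μ2 h0 h1 h2 CG 0 j k l + (min (h1 / μ1) (h2 / μ2) + h0 / μ0)
      ≤ v μ0 μ1 μ2 h0 h1 h2 CG 0 (j + 1) k l := by
  induction n using Nat.strong_induction_on with
  | _ n ih =>
  intro j k l hn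
  have e := v_zero_eq h0 h1 h2 hCG hμ0 hμ1 hμ2 j k l
  have e' := v_zero_eq h0 h1 h2 hCG hμ0 hμ1 hμ2 (j + 1) k l
  have hd := dRate_pos hCG hμ0 hμ1 hμ2 (j + 1) k l (by omega)
  have tm : v μ0 μ1 μ2 h0 h1 h2 CG 0 j k l + min (h1 / μ1) (h2 / μ2) ≤
      min (v μ0 μ1 μ2 h0 h1 h2 CG 0 j (k + 1) l) (v μ0 μ1 μ2 h0 h1 h2 CG 0 j k (l + 1)) := by
    have a1 := extra_one h0 h1 h2 hCG hμ0 hμ1 hμ2 _ j k l rfl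
    have a2 := extra_two h0 h1 h2 hCG hμ0 hμ1 hμ2 hh2 _ j k l rfl
    have b1 := min_le_left (h1 / μ1) (h2 / μ2)
    have b2 := min_le_right (h1 / μ1) (h2 / μ2)
    exact le_min (by linarith) (by linarith)
  generalize min (h1 / μ1) (h2 / μ2) = m at *
  have t0 := guarded_le j j le_rfl hμ0
    (x := min (v μ0 μ1 μ2 h0 h1 h2 CG 0 j (k + 1) l)
      (v μ0 μ1 μ2 h0 h1 h2 CG 0 j k (l + 1)))
    (y := min (v μ0 μ1 μ2 h0 h1 h2 CG 0 (j - 1) (k + 1) l)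
      (v μ0 μ1 μ2 h0 h1 h2 CG 0 (j - 1) k (l + 1))) (c := m + h0 / μ0)
    (fun hj => by
      have a1 := ih _ (by omega) (j - 1) (k + 1) l rfl
      have a2 := ih _ (by omega) (j - 1) k (l + 1) rfl
      rw [Nat.sub_add_cancel hj] at a1 a2
      exact min_add_le a1 a2)
  have t1 := guarded_le k k le_rfl hμ1
    (x := v μ0 μ1 μ2 h0 h1 h2 CG 0 (j + 1) (k - 1) l)
    (y := v μ0 μ1 μ2 h0 h1 h2 CG 0 j (k - 1) l) (c := m + h0 / μ0)
    (fun hk => ih _ (by omega) j (k - 1) l rfl)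
  have t2 := guarded_le l (min l CG) (min_le_left _ _) hμ2
    (x := v μ0 μ1 μ2 h0 h1 h2 CG 0 (j + 1) k (l - 1))
    (y := v μ0 μ1 μ2 h0 h1 h2 CG 0 j k (l - 1)) (c := m + h0 / μ0)
    (fun hl => ih _ (by omega) j k (l - 1) rfl)
  have hh : h0 = μ0 * (h0 / μ0) := by field_simp
  have tm' := mul_le_mul_of_nonneg_left tm hμ0.le
  refine le_of_mul_le_mul_left ?_ hd
  simp only [Nat.add_sub_cancel] at e'
  unfold dRate at *
  generalize h0 / μ0 = a at *
  push_cast at *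
  linarith

theorem main_bound (Cp CG : ℕ) (μ0 μ1 μ2 h0 h1 h2 : ℝ)
    (hCp : 0 < Cp) (hCG : 0 < CG)
    (hμ0 : 0 < μ0) (hμ1 : 0 < μ1) (hμ2 : 0 < μ2)
    (hh0 : 0 < h0) (hh2 : 0 < h2) (n : ℕ) :
    ∀ i j k l : ℕ, 2 * (i + j) + k + l = n → j + k + l = Cp →
      v μ0 μ1 μ2 h0 h1 h2 CG i j k l + (min (h1 / μ1) (h2 / μ2)
          + ((i : ℝ) + (j : ℝ) + 1) * (h0 / Cp / μ0)
          + ((i : ℝ) + 1) * (h0 / Cp * min (1 / μ1) (1 / μ2))) ≤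
        v μ0 μ1 μ2 h0 h1 h2 CG (i + 1) j k l := by
  have hCpR : (0 : ℝ) < Cp := by exact_mod_cast hCp
  have hq : 0 < h0 / Cp := by positivity
  have hqC : h0 = Cp * (h0 / Cp) := by field_simp
  have hw1 : μ1 * min (1 / μ1) (1 / μ2) ≤ 1 := by
    calc μ1 * min (1 / μ1) (1 / μ2) ≤ μ1 * (1 / μ1) :=
          mul_le_mul_of_nonneg_left (min_le_left _ _) hμ1.le
      _ = 1 := by field_simp
  have hw2 : μ2 * min (1 / μ1) (1 / μ2) ≤ 1 := by
    calc μ2 * min (1 / μ1) (1 / μ2) ≤ μ2 * (1 / μ2) :=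
          mul_le_mul_of_nonneg_left (min_le_right _ _) hμ2.le
      _ = 1 := by field_simp
  have hext := fun j k l => extra_zero h0 h1 h2 hCG hμ0 hμ1 hμ2 hh2 _ j k l rfl
  have hr : h0 / Cp = μ0 * (h0 / Cp / μ0) := by field_simp
  have hr' : h0 / μ0 = Cp * (h0 / Cp / μ0) := by field_simp
  have hrpos : 0 < h0 / Cp / μ0 := by positivity
  rw [hr'] at hext
  generalize min (1 / μ1) (1 / μ2) = w at *
  generalize min (h1 / μ1) (h2 / μ2) = m at *
  generalize h0 / Cp / μ0 = r at *
  generalize h0 / Cp = q at *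
  induction n using Nat.strong_induction_on with
  | _ n ih =>
  intro i j k l hn hC
  have hd := dRate_pos hCG hμ0 hμ1 hμ2 j k l (by omega)
  have e' := v_succ_eq h0 h1 h2 hCG hμ0 hμ1 hμ2 i j k l (by omega)
  have hCR : (Cp : ℝ) = j + k + l := by exact_mod_cast hC.symm
  have hkw : (k : ℝ) * q * (μ1 * w) ≤ (k : ℝ) * q * 1 :=
    mul_le_mul_of_nonneg_left hw1 (by positivity)
  have hlw : ((min l CG : ℕ) : ℝ) * q * (μ2 * w) ≤ ((min l CG : ℕ) : ℝ) * q * 1 :=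
    mul_le_mul_of_nonneg_left hw2 (by positivity)
  have hll : ((min l CG : ℕ) : ℝ) * q ≤ (l : ℝ) * q :=
    mul_le_mul_of_nonneg_right (by exact_mod_cast min_le_left l CG) hq.le
  have t0 := guarded_le j j le_rfl hμ0
    (x := min (v μ0 μ1 μ2 h0 h1 h2 CG (i + 1) (j - 1) (k + 1) l)
      (v μ0 μ1 μ2 h0 h1 h2 CG (i + 1) (j - 1) k (l + 1)))
    (y := min (v μ0 μ1 μ2 h0 h1 h2 CG i (j - 1) (k + 1) l)
      (v μ0 μ1 μ2 h0 h1 h2 CG i (j - 1) k (l + 1)))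
    (c := m + ((i : ℝ) + j) * r + ((i : ℝ) + 1) * (q * w))
    (fun hj => by
      have a1 := ih _ (by omega) i (j - 1) (k + 1) l rfl (by omega)
      have a2 := ih _ (by omega) i (j - 1) k (l + 1) rfl (by omega)
      have hjc : ((j - 1 : ℕ) : ℝ) = (j : ℝ) - 1 := by push_cast [hj]; ring
      rw [hjc] at a1 a2
      have hs : (i : ℝ) + ((j : ℝ) - 1) + 1 = i + j := by ring
      rw [hs] at a1 a2
      exact min_add_le a1 a2)
  refine le_of_mul_le_mul_left ?_ hd
  have hh : h0 = ((j : ℝ) + k + l) * q := by rw [← hCR]; exact hqC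
  have hjr : (j : ℝ) * q = (j : ℝ) * (μ0 * r) := by rw [← hr]
  rcases i with _ | i
  · have e := v_zero_eq h0 h1 h2 hCG hμ0 hμ1 hμ2 j k l
    have t1 := guarded_le k k le_rfl hμ1
      (x := v μ0 μ1 μ2 h0 h1 h2 CG 0 (j + 1) (k - 1) l)
      (y := v μ0 μ1 μ2 h0 h1 h2 CG 0 j (k - 1) l) (c := m + ((j : ℝ) + 1) * r)
      (fun hk => by
        have a := hext j (k - 1) l
        have : ((j : ℝ) + 1) * r ≤ Cp * r := by
          apply mul_le_mul_of_nonneg_right _ hrpos.le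
          exact_mod_cast (by omega : j + 1 ≤ Cp)
        linarith)
    have t2 := guarded_le l (min l CG) (min_le_left _ _) hμ2
      (x := v μ0 μ1 μ2 h0 h1 h2 CG 0 (j + 1) k (l - 1))
      (y := v μ0 μ1 μ2 h0 h1 h2 CG 0 j k (l - 1)) (c := m + ((j : ℝ) + 1) * r)
      (fun hl => by
        have a := hext j k (l - 1)
        have : ((j : ℝ) + 1) * r ≤ Cp * r := by
          apply mul_le_mul_of_nonneg_right _ hrpos.le
          exact_mod_cast (by omega : j + 1 ≤ Cp)
        linarith)
    rw [mul_add, e, e']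
    unfold dRate
    simp only [Nat.cast_zero, zero_add] at *
    linarith
  · have e := v_succ_eq h0 h1 h2 hCG hμ0 hμ1 hμ2 i j k l (by omega)
    have t1 := guarded_le k k le_rfl hμ1
      (x := v μ0 μ1 μ2 h0 h1 h2 CG (i + 1) (j + 1) (k - 1) l)
      (y := v μ0 μ1 μ2 h0 h1 h2 CG i (j + 1) (k - 1) l)
      (c := m + ((i : ℝ) + j + 2) * r + ((i : ℝ) + 1) * (q * w))
      (fun hk => by
        have a := ih _ (by omega) i (j + 1) (k - 1) l rfl (by omega)
        push_cast at a
        linarith)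
    have t2 := guarded_le l (min l CG) (min_le_left _ _) hμ2
      (x := v μ0 μ1 μ2 h0 h1 h2 CG (i + 1) (j + 1) k (l - 1))
      (y := v μ0 μ1 μ2 h0 h1 h2 CG i (j + 1) k (l - 1))
      (c := m + ((i : ℝ) + j + 2) * r + ((i : ℝ) + 1) * (q * w))
      (fun hl => by
        have a := ih _ (by omega) i (j + 1) k (l - 1) rfl (by omega)
        push_cast at a
        linarith)
    rw [mul_add, e, e']
    unfold dRate
    simp only [Nat.cast_add, Nat.cast_one] at *
    linarith

theorem stmt13 (Cp CG : ℕ) (μ0 μ1 μ2 h0 h1 h2 : ℝ)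
    (hCp : 0 < Cp) (hCG : 0 < CG) (hCpCG : CG < Cp)
    (hμ0 : 0 < μ0) (hμ1 : 0 < μ1) (hμ2 : 0 < μ2)
    (hh0 : 0 < h0) (hh1 : 0 < h1) (hh2 : 0 < h2)
    : ∀ i j k l : ℕ, j + k + l = Cp →
      min (h1 / μ1) (h2 / μ2)
          + (((i : ℝ) + (j : ℝ) + 1) * h0 / (Cp : ℝ)) * (1 / μ0)
          + (((i : ℝ) + 1) * h0 / (Cp : ℝ)) * min (1 / μ1) (1 / μ2) ≤
        v μ0 μ1 μ2 h0 h1 h2 CG (i + 1) j k l - v μ0 μ1 μ2 h0 h1 h2 CG i j k l ∧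
      min (h1 / μ1) (h2 / μ2) ≤ v μ0 μ1 μ2 h0 h1 h2 CG (i + 1) j k l - v μ0 μ1 μ2 h0 h1 h2 CG i j k l := by
  intro i j k l hC
  have h := main_bound Cp CG μ0 μ1 μ2 h0 h1 h2 hCp hCG hμ0 hμ1 hμ2 hh0 hh2 _ i j k l rfl hC
  have hCpR : (0 : ℝ) < Cp := by exact_mod_cast hCp
  have hx : (((i : ℝ) + (j : ℝ) + 1) * h0 / (Cp : ℝ)) * (1 / μ0)
      = ((i : ℝ) + (j : ℝ) + 1) * (h0 / Cp / μ0) := by ring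
  have hy : (((i : ℝ) + 1) * h0 / (Cp : ℝ)) * min (1 / μ1) (1 / μ2)
      = ((i : ℝ) + 1) * (h0 / Cp * min (1 / μ1) (1 / μ2)) := by ring
  have hx0 : 0 ≤ ((i : ℝ) + (j : ℝ) + 1) * (h0 / Cp / μ0) := by positivity
  have hy0 : 0 ≤ ((i : ℝ) + 1) * (h0 / Cp * min (1 / μ1) (1 / μ2)) := by
    have : 0 < min (1 / μ1) (1 / μ2) := lt_min (by positivity) (by positivity)
    positivity
  rw [hx, hy]
  constructor <;> linarith
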